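/- Let K be a field and let τ = [μ,ν : E → V] be a regular transformation-pair over K, i.e., dim_K E = dim_K V and there exists c ∈ K such that μ + cν is invertible. Then τ is isomorphic to a finite direct sum of transformation-pairs of the types ^0T_n (n ≥ 1), T^0_n (n ≥ 1), and S(p^n) (p a monic irreducible polynomial in K[X] with p ≠ X, n ≥ 1). -/

import Mathlib

open Polynomial

namespace Towber

/-- A transformation-pair over `K`: two `K`-linear maps between
finite-dimensional `K`-vector spaces. -/
structure Pair (K : Type) [Field K] where
  E : Type
  V : Type
  [addE : AddCommGroup E]
  [modE : Module K E]
  [finE : FiniteDimensional K E]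
  [addV : AddCommGroup V]
  [modV : Module K V]
  [finV : FiniteDimensional K V]
  mu : E →ₗ[K] V
  nu : E →ₗ[K] V

attribute [instance] Pair.addE Pair.modE Pair.finE Pair.addV Pair.modV Pair.finV

variable (K : Type) [Field K]

/-- Isomorphism of transformation-pairs. -/
def Pair.Iso (τ σ : Pair K) : Prop :=
  ∃ (α : τ.E ≃ₗ[K] σ.E) (β : τ.V ≃ₗ[K] σ.V),
    (∀ x, σ.mu (α x) = β (τ.mu x)) ∧ (∀ x, σ.nu (α x) = β (τ.nu x))

/-- Finite direct sum of transformation-pairs. -/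
noncomputable def dSum (ι : Type) [Finite ι] (τ : ι → Pair K) : Pair K :=
  letI := Fintype.ofFinite ι
  { E := ∀ i, (τ i).E
    V := ∀ i, (τ i).V
    mu := LinearMap.pi fun i => (τ i).mu ∘ₗ LinearMap.proj i
    nu := LinearMap.pi fun i => (τ i).nu ∘ₗ LinearMap.proj i }

/-- Binary direct sum of transformation-pairs. -/
noncomputable def dSum2 (τ σ : Pair K) : Pair K where
  E := τ.E × σ.E
  V := τ.V × σ.V
  mu := τ.mu.prodMap σ.mu
  nu := τ.nu.prodMap σ.nu

/-- A transformation-pair built from a pair of matrices. -/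
noncomputable def ofMats {a b : ℕ} (M N : Matrix (Fin b) (Fin a) K) : Pair K where
  E := Fin a → K
  V := Fin b → K
  mu := Matrix.toLin' M
  nu := Matrix.toLin' N

/-- `^0T_n = [μ_n, I : K^n → K^n]`, where `μ_n` maps `f_i ↦ f_{i+1}`, `f_n ↦ 0`. -/
noncomputable def zT (n : ℕ) : Pair K :=
  ofMats K (Matrix.of fun j i : Fin n => if (i : ℕ) + 1 = (j : ℕ) then 1 else 0) 1

/-- `T^0_n = [I, μ_n : K^n → K^n]`. -/
noncomputable def Tz (n : ℕ) : Pair K :=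
  ofMats K 1 (Matrix.of fun j i : Fin n => if (i : ℕ) + 1 = (j : ℕ) then 1 else 0)

/-- `T_n = [κ_n, λ_n : K^n → K^{n+1}]`, `κ_n : f_i ↦ f_i`, `λ_n : f_i ↦ f_{i+1}`. -/
noncomputable def Tn (n : ℕ) : Pair K :=
  ofMats K (Matrix.of fun (j : Fin (n+1)) (i : Fin n) => if (j : ℕ) = (i : ℕ) then 1 else 0)
    (Matrix.of fun (j : Fin (n+1)) (i : Fin n) => if (j : ℕ) = (i : ℕ) + 1 then 1 else 0)

/-- `^0T^0_n = [κ'_n, λ'_n : K^{n+1} → K^n]`. -/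
noncomputable def zTz (n : ℕ) : Pair K :=
  ofMats K (Matrix.of fun (j : Fin n) (i : Fin (n+1)) => if (j : ℕ) = (i : ℕ) then 1 else 0)
    (Matrix.of fun (j : Fin n) (i : Fin (n+1)) => if (j : ℕ) + 1 = (i : ℕ) then 1 else 0)

/-- `S(F) = [·X, I : K[X]/(F) → K[X]/(F)]` for a nonzero polynomial `F`. -/
noncomputable def SP (F : Polynomial K) (hF : F ≠ 0) : Pair K :=
  letI : FiniteDimensional K (AdjoinRoot F) := (AdjoinRoot.powerBasis hF).finite
  { E := AdjoinRoot F
    V := AdjoinRoot F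
    mu := LinearMap.mulLeft K (AdjoinRoot.root F)
    nu := LinearMap.id }

/-- Membership in Kronecker's list `L(K)` (up to isomorphism). -/
def IsKron (σ : Pair K) : Prop :=
  (∃ n, 1 ≤ n ∧ Pair.Iso K σ (zT K n)) ∨
  (∃ n, 1 ≤ n ∧ Pair.Iso K σ (Tz K n)) ∨
  (∃ n, Pair.Iso K σ (Tn K n)) ∨
  (∃ n, Pair.Iso K σ (zTz K n)) ∨
  (∃ (p : Polynomial K) (n : ℕ), p.Monic ∧ Irreducible p ∧ p ≠ X ∧ 1 ≤ n ∧
    ∃ h : p ^ n ≠ 0, Pair.Iso K σ (SP K (p ^ n) h))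

/-- Being of type `S(p^n)` with `p` monic irreducible, `p ≠ X`, `n ≥ 1`. -/
def IsSType (σ : Pair K) : Prop :=
  ∃ (p : Polynomial K) (n : ℕ), p.Monic ∧ Irreducible p ∧ p ≠ X ∧ 1 ≤ n ∧
    ∃ h : p ^ n ≠ 0, Pair.Iso K σ (SP K (p ^ n) h)

/-- Membership in Weierstrass' (regular) part of Kronecker's list. -/
def IsKronReg (σ : Pair K) : Prop :=
  (∃ n, 1 ≤ n ∧ Pair.Iso K σ (zT K n)) ∨
  (∃ n, 1 ≤ n ∧ Pair.Iso K σ (Tz K n)) ∨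
  (∃ (p : Polynomial K) (n : ℕ), p.Monic ∧ Irreducible p ∧ p ≠ X ∧ 1 ≤ n ∧
    ∃ h : p ^ n ≠ 0, Pair.Iso K σ (SP K (p ^ n) h))

/-- A finite binary relation `(R, S)`. -/
structure BRel where
  S : Type
  R : S → S → Prop
  [fin : Finite S]

attribute [instance] BRel.fin

/-- The generating relation for left contraction:
`y ~ y'` whenever `∃ x, xRy ∧ xRy'`. -/
def BRel.lgen (Γ : BRel) : Γ.S → Γ.S → Prop := fun y y' => ∃ x, Γ.R x y ∧ Γ.R x y'

/-- The generating relation for right contraction: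
`x ~ x'` whenever `∃ y, xRy ∧ x'Ry`. -/
def BRel.rgen (Γ : BRel) : Γ.S → Γ.S → Prop := fun x x' => ∃ y, Γ.R x y ∧ Γ.R x' y

/-- Quotient of a binary relation by (the equivalence relation generated by) `r`:
two classes are related iff some representatives are related. -/
def BRel.quotBy (Γ : BRel) (r : Γ.S → Γ.S → Prop) : BRel where
  S := Quot r
  R := fun α β => ∃ a b, Quot.mk r a = α ∧ Quot.mk r b = β ∧ Γ.R a b

/-- Left contraction `C_l Γ`. -/
def BRel.Cl (Γ : BRel) : BRel := Γ.quotBy Γ.lgen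

/-- Right contraction `C_r Γ`. -/
def BRel.Cr (Γ : BRel) : BRel := Γ.quotBy Γ.rgen

/-- Graph-isomorphism of binary relations. -/
def BRel.Iso (Γ Δ : BRel) : Prop :=
  ∃ φ : Γ.S ≃ Δ.S, ∀ a b, Δ.R (φ a) (φ b) ↔ Γ.R a b

/-- `γ_{m,n}(Γ)`, the number of vertices of `C_l^m C_r^n Γ`. -/
noncomputable def BRel.gamma (Γ : BRel) (m n : ℕ) : ℕ :=
  Nat.card ((BRel.Cl^[m] (BRel.Cr^[n] Γ)).S)

/-- `Γ` has stabilized at `N`: for all `m, n ≥ N` the iterated contraction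
`C_l^m C_r^n Γ` is graph-isomorphic to `C_l^N C_r^N Γ`. -/
def BRel.StabAt (Γ : BRel) (N : ℕ) : Prop :=
  ∀ m, N ≤ m → ∀ n, N ≤ n →
    BRel.Iso (BRel.Cl^[m] (BRel.Cr^[n] Γ)) (BRel.Cl^[N] (BRel.Cr^[N] Γ))

/-- Number of edges of a binary relation. -/
noncomputable def BRel.edges (Γ : BRel) : ℕ :=
  Nat.card {p : Γ.S × Γ.S // Γ.R p.1 p.2}

/-- The `K`-linearization of a finite binary relation. -/
noncomputable def BRel.linz (Γ : BRel) : Pair K :=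
  letI := Fintype.ofFinite Γ.S
  letI := Classical.decEq Γ.S
  letI : DecidablePred (fun p : Γ.S × Γ.S => Γ.R p.1 p.2) := Classical.decPred _
  { E := {p : Γ.S × Γ.S // Γ.R p.1 p.2} → K
    V := Γ.S → K
    mu := Matrix.toLin' (Matrix.of fun (v : Γ.S) (e : {p : Γ.S × Γ.S // Γ.R p.1 p.2}) =>
      if e.1.1 = v then 1 else 0)
    nu := Matrix.toLin' (Matrix.of fun (v : Γ.S) (e : {p : Γ.S × Γ.S // Γ.R p.1 p.2}) =>
      if e.1.2 = v then 1 else 0) }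

/-- The disjoint union of the paths `L_{m i}` (on `m i` vertices) and the
cycles `C_{c j}` (on `c j` vertices). -/
def modelGraph (p q : ℕ) (m : Fin p → ℕ) (c : Fin q → ℕ) : BRel where
  S := (Σ i, Fin (m i)) ⊕ (Σ j, Fin (c j))
  R := fun x y =>
    (∃ (i : Fin p) (a b : Fin (m i)),
        x = Sum.inl ⟨i, a⟩ ∧ y = Sum.inl ⟨i, b⟩ ∧ (b : ℕ) = (a : ℕ) + 1) ∨
    (∃ (j : Fin q) (a b : Fin (c j)),
        x = Sum.inr ⟨j, a⟩ ∧ y = Sum.inr ⟨j, b⟩ ∧ (b : ℕ) = ((a : ℕ) + 1) % (c j))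

/-- A finite directed graph, possibly with parallel edges. -/
structure DiGraph where
  E : Type
  V : Type
  [finE : Finite E]
  [finV : Finite V]
  init : E → V
  term : E → V

attribute [instance] DiGraph.finE DiGraph.finV

/-- The parallelism relation on the edges of a directed graph. -/
def DiGraph.par (G : DiGraph) : G.E → G.E → Prop :=
  fun e e' => G.init e = G.init e' ∧ G.term e = G.term e'

/-- The reduced form of a directed graph: edges are parallelism classes. -/
def DiGraph.red (G : DiGraph) : DiGraph where
  E := Quot G.par
  V := G.V
  init := Quot.lift G.init fun _ _ h => h.1
  term := Quot.lift G.term fun _ _ h => h.2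

/-- The `K`-linearization of a finite directed graph. -/
noncomputable def DiGraph.linz (G : DiGraph) : Pair K :=
  letI := Fintype.ofFinite G.E
  letI := Fintype.ofFinite G.V
  letI := Classical.decEq G.V
  letI := Classical.decEq G.E
  { E := G.E → K
    V := G.V → K
    mu := Matrix.toLin' (Matrix.of fun (v : G.V) (e : G.E) => if G.init e = v then 1 else 0)
    nu := Matrix.toLin' (Matrix.of fun (v : G.V) (e : G.E) => if G.term e = v then 1 else 0) }

/-- The pair `[f, g : E → E]` of two endomorphisms of one space. -/
def endoPair {K E : Type} [Field K] [AddCommGroup E] [Module K E] [FiniteDimensional K E]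
    (f g : Module.End K E) : Pair K where
  E := E
  V := E
  mu := f
  nu := g

/-- A pair isomorphic to a finite direct sum of pairs in the regular part of Kronecker's list. -/
def IsSumOfKronReg {K : Type} [Field K] (τ : Pair K) : Prop :=
  ∃ (ι : Type) (_ : Finite ι) (σ : ι → Pair K), (∀ i, IsKronReg K (σ i)) ∧
    Pair.Iso K τ (dSum K ι σ)

section

variable {K}

theorem Pair.Iso.trans {τ σ ρ : Pair K} (h : Pair.Iso K τ σ) (h' : Pair.Iso K σ ρ) :
    Pair.Iso K τ ρ := by
  obtain ⟨α, β, h1, h2⟩ := h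
  obtain ⟨α', β', h3, h4⟩ := h'
  exact ⟨α.trans α', β.trans β', fun x => by simp [h1, h3], fun x => by simp [h2, h4]⟩

theorem dSum_congr {ι : Type} [Finite ι] {τ σ : ι → Pair K} (h : ∀ i, Pair.Iso K (τ i) (σ i)) :
    Pair.Iso K (dSum K ι τ) (dSum K ι σ) := by
  choose α β h1 h2 using h
  exact ⟨LinearEquiv.piCongrRight α, LinearEquiv.piCongrRight β,
    fun x => funext fun i => h1 i (x i), fun x => funext fun i => h2 i (x i)⟩

theorem dSum_sigma {ι : Type} [Finite ι] {κ : ι → Type} [∀ i, Finite (κ i)]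
    (σ : ∀ i, κ i → Pair K) :
    Pair.Iso K (dSum K ι fun i => dSum K (κ i) (σ i))
      (dSum K (Σ i, κ i) fun j => σ j.1 j.2) :=
  ⟨(LinearEquiv.piCurry K fun i j => (σ i j).E).symm,
    (LinearEquiv.piCurry K fun i j => (σ i j).V).symm, fun _ => rfl, fun _ => rfl⟩

theorem dSum_reindex {ι κ : Type} [Finite ι] [Finite κ] (e : ι ≃ κ) (σ : ι → Pair K) :
    Pair.Iso K (dSum K ι σ) (dSum K κ fun i => σ (e.symm i)) :=
  ⟨LinearEquiv.piCongrLeft' K (fun i => (σ i).E) e, LinearEquiv.piCongrLeft' K (fun i => (σ i).V) e,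
    fun _ => rfl, fun _ => rfl⟩

theorem dSum_punit (τ : Pair K) : Pair.Iso K τ (dSum K PUnit fun _ => τ) :=
  ⟨(LinearEquiv.funUnique PUnit K τ.E).symm, (LinearEquiv.funUnique PUnit K τ.V).symm,
    fun _ => rfl, fun _ => rfl⟩

theorem IsSumOfKronReg.of_iso {τ σ : Pair K} (h : IsSumOfKronReg σ) (e : Pair.Iso K τ σ) :
    IsSumOfKronReg τ := by
  obtain ⟨ι, hι, ρ, hρ, e'⟩ := h
  exact ⟨ι, hι, ρ, hρ, e.trans e'⟩

theorem IsSumOfKronReg.dSum {ι : Type} [Finite ι] {τ : ι → Pair K}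
    (h : ∀ i, IsSumOfKronReg (τ i)) : IsSumOfKronReg (dSum K ι τ) := by
  choose κ hκ σ hσ e using h
  exact ⟨Σ i, κ i, inferInstance, fun j => σ j.1 j.2, fun j => hσ j.1 j.2,
    (dSum_congr e).trans (dSum_sigma σ)⟩

theorem IsKronReg.isSumOfKronReg {τ : Pair K} (h : IsKronReg K τ) : IsSumOfKronReg τ :=
  ⟨PUnit, inferInstance, fun _ => τ, fun _ => h, dSum_punit τ⟩

theorem IsSumOfKronReg.of_subsingleton (τ : Pair K) [Subsingleton τ.E] [Subsingleton τ.V] :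
    IsSumOfKronReg τ := by
  refine ⟨PEmpty, inferInstance, PEmpty.elim, fun i => i.elim, ?_⟩
  have : Subsingleton (Towber.dSum K PEmpty PEmpty.elim).E :=
    inferInstanceAs (Subsingleton (∀ i : PEmpty, (PEmpty.elim i : Pair K).E))
  have : Subsingleton (Towber.dSum K PEmpty PEmpty.elim).V :=
    inferInstanceAs (Subsingleton (∀ i : PEmpty, (PEmpty.elim i : Pair K).V))
  exact ⟨0, 0, fun _ => Subsingleton.elim _ _, fun _ => Subsingleton.elim _ _⟩

theorem finiteDimensional_adjoinRoot {F : K[X]} (hF : F ≠ 0) :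
    FiniteDimensional K (AdjoinRoot F) :=
  (AdjoinRoot.powerBasis hF).finite

theorem subsingleton_adjoinRoot_pow_zero (p : K[X]) : Subsingleton (AdjoinRoot (p ^ 0)) := by
  refine subsingleton_of_zero_eq_one ?_
  rw [← map_one (AdjoinRoot.mk (p ^ 0)), eq_comm, AdjoinRoot.mk_eq_zero, pow_zero]

/-- Primary decomposition of an endomorphism of a finite-dimensional space. -/
theorem exists_equiv_pi_adjoinRoot {E : Type} [AddCommGroup E] [Module K E]
    [FiniteDimensional K E] (f : Module.End K E) :
    ∃ (ι : Type) (_ : Finite ι) (p : ι → K[X]) (e : ι → ℕ), (∀ i, (p i).Monic) ∧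
      (∀ i, Irreducible (p i)) ∧ ∃ α : E ≃ₗ[K] ∀ i, AdjoinRoot (p i ^ e i),
        ∀ x i, α (f x) i = AdjoinRoot.root (p i ^ e i) * α x i := by
  classical
  obtain ⟨ι, hι, p, hp, e, ⟨h⟩⟩ := Module.equiv_directSum_of_isTorsion (R := K[X])
    (Module.AEval.isTorsion_of_finiteDimensional K E f)
  have hspan (i) : Submodule.span K[X] {p i ^ e i} =
      Ideal.span {(normalize (p i)) ^ e i} :=
    Ideal.span_singleton_eq_span_singleton.2 ((normalize_associated (p i)).symm.pow_pow)
  let Φ : Module.AEval K E f ≃ₗ[K[X]] ∀ i, K[X] ⧸ Ideal.span {(normalize (p i)) ^ e i} :=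
    (h.trans (DirectSum.linearEquivFunOnFintype K[X] ι _)).trans
      (LinearEquiv.piCongrRight fun i => Submodule.quotEquivOfEq _ _ (hspan i))
  refine ⟨ι, inferInstance, fun i => normalize (p i), e,
    fun i => monic_normalize (hp i).ne_zero,
    fun i => (normalize_associated (p i)).symm.irreducible (hp i),
    (Module.AEval.of K E f).trans (Φ.restrictScalars K), fun x i => ?_⟩
  have hX := congrFun (Φ.map_smul X (Module.AEval.of K E f x)) i
  rw [Module.AEval.X_smul_of] at hX
  have hroot (F : K[X]) (y : K[X] ⧸ Ideal.span {F}) :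
      (X : K[X]) • y = Ideal.Quotient.mk (Ideal.span {F}) X * y := by
    obtain ⟨z, rfl⟩ := Ideal.Quotient.mk_surjective y
    rfl
  exact hX.trans (hroot _ _)

/-- A pair of polynomials in `f` decomposes along the primary decomposition of `f`. -/
theorem IsSumOfKronReg.endoPair_aeval {E : Type} [AddCommGroup E] [Module K E]
    [FiniteDimensional K E] (f : Module.End K E) (a b : K[X])
    (h : ∀ (p : K[X]) (n : ℕ) [FiniteDimensional K (AdjoinRoot (p ^ n))], p.Monic →
      Irreducible p →
      (∃ π : E →ₗ[K] AdjoinRoot (p ^ n), Function.Surjective π ∧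
        ∀ x, π (f x) = AdjoinRoot.root (p ^ n) * π x) →
      IsSumOfKronReg (endoPair (LinearMap.mulLeft K (AdjoinRoot.mk (p ^ n) a))
        (LinearMap.mulLeft K (AdjoinRoot.mk (p ^ n) b)))) :
    IsSumOfKronReg (endoPair (aeval f a) (aeval f b)) := by
  obtain ⟨ι, _, p, e, hm, hp, α, hα⟩ := exists_equiv_pi_adjoinRoot f
  have hfin (i) : FiniteDimensional K (AdjoinRoot (p i ^ e i)) :=
    finiteDimensional_adjoinRoot (pow_ne_zero _ (hp i).ne_zero)
  have key (q : K[X]) (x : E) (i : ι) :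
      α (aeval f q x) i = AdjoinRoot.mk (p i ^ e i) q * α x i := by
    induction q using Polynomial.induction_on generalizing x with
    | C c => simp [Algebra.smul_def, AdjoinRoot.algebraMap_eq]
    | add q r hq hr => simp [hq, hr, add_mul]
    | monomial n c ih =>
      have : aeval f (C c * X ^ (n + 1)) x = aeval f (C c * X ^ n) (f x) := by
        rw [pow_succ, ← mul_assoc, map_mul, aeval_X]; rfl
      rw [this, ih, hα, pow_succ, ← mul_assoc (C c), map_mul _ _ X, AdjoinRoot.mk_X,
        mul_assoc]
  refine (IsSumOfKronReg.dSum (τ := fun i =>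
    endoPair (LinearMap.mulLeft K (AdjoinRoot.mk (p i ^ e i) a))
      (LinearMap.mulLeft K (AdjoinRoot.mk (p i ^ e i) b)))
    fun i => h (p i) (e i) (hm i) (hp i)
      ⟨LinearMap.proj i ∘ₗ α.toLinearMap, (Function.surjective_eval i).comp α.surjective,
        fun x => hα x i⟩).of_iso
    ⟨α, α, fun x => funext fun i => (key a x i).symm, fun x => funext fun i => (key b x i).symm⟩

/-- Multiplication by `X` on `K[X]/(X^n)` is the shift matrix in the basis of powers of `X`. -/
theorem exists_equiv_shift (n : ℕ) :
    ∃ β : AdjoinRoot ((X : K[X]) ^ n) ≃ₗ[K] (Fin n → K), ∀ x,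
      Matrix.toLin' (Matrix.of fun j i : Fin n => if (i : ℕ) + 1 = (j : ℕ) then (1 : K) else 0)
        (β x) = β (AdjoinRoot.root (X ^ n) * x) := by
  have hX : (X : K[X]) ^ n ≠ 0 := pow_ne_zero _ X_ne_zero
  let b := (AdjoinRoot.powerBasis hX).basis.reindex (finCongr (natDegree_X_pow n))
  have hb (i : Fin n) : b i = AdjoinRoot.root (X ^ n) ^ (i : ℕ) := by
    rw [Module.Basis.reindex_apply, PowerBasis.basis_eq_pow]
    rfl
  refine ⟨b.equivFun, fun x => ?_⟩
  suffices h : Matrix.toLin' (Matrix.of fun j i : Fin n =>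
      if (i : ℕ) + 1 = (j : ℕ) then (1 : K) else 0) ∘ₗ b.equivFun.toLinearMap =
      b.equivFun.toLinearMap ∘ₗ LinearMap.mulLeft K (AdjoinRoot.root (X ^ n)) from
    LinearMap.congr_fun h x
  refine b.ext fun i => funext fun j => ?_
  have hmul : AdjoinRoot.root ((X : K[X]) ^ n) * b i = AdjoinRoot.root (X ^ n) ^ ((i : ℕ) + 1) := by
    rw [hb, pow_succ']
  simp only [LinearMap.comp_apply, LinearEquiv.coe_coe, LinearMap.mulLeft_apply, hmul]
  by_cases hi : (i : ℕ) + 1 < n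
  · rw [← hb ⟨i + 1, hi⟩]
    simp [Finsupp.single_eq_pi_single, Fin.ext_iff, eq_comm]
  · have h0 : AdjoinRoot.root ((X : K[X]) ^ n) ^ ((i : ℕ) + 1) = 0 := by
      rw [← AdjoinRoot.mk_X, ← map_pow, AdjoinRoot.mk_eq_zero]
      exact pow_dvd_pow _ (by omega)
    rw [h0]
    have : (i : ℕ) + 1 ≠ j := by omega
    simp [Finsupp.single_eq_pi_single, this]

theorem IsSumOfKronReg.endoPair_one {E : Type} [AddCommGroup E] [Module K E]
    [FiniteDimensional K E] (f : Module.End K E) : IsSumOfKronReg (endoPair f 1) := by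
  suffices h : IsSumOfKronReg (endoPair (aeval f (X : K[X])) (aeval f (1 : K[X]))) by
    rwa [aeval_X, map_one] at h
  refine IsSumOfKronReg.endoPair_aeval f X 1 fun p n _ hm hp _ => ?_
  rcases Nat.eq_zero_or_pos n with rfl | hn
  · have := subsingleton_adjoinRoot_pow_zero p
    exact @IsSumOfKronReg.of_subsingleton _ _ (endoPair _ _) this this
  refine IsKronReg.isSumOfKronReg ?_
  rw [AdjoinRoot.mk_X, map_one]
  by_cases hX : p = X
  · subst hX
    obtain ⟨β, hβ⟩ := exists_equiv_shift (K := K) n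
    exact .inl ⟨n, hn, β, β, hβ, fun x => by simp [endoPair, zT, ofMats]; rfl⟩
  · exact .inr (.inr ⟨p, n, hm, hp, hX, hn, pow_ne_zero _ hp.ne_zero,
      .refl K _, .refl K _, fun _ => rfl, fun x => (one_mul (M := AdjoinRoot (p ^ n)) x).symm⟩)

theorem eq_X_of_isNilpotent_root {p : K[X]} {n : ℕ} (hn : 0 < n) (hm : p.Monic)
    (hp : Irreducible p) (h : IsNilpotent (AdjoinRoot.root (p ^ n))) : p = X := by
  obtain ⟨m, hm'⟩ := h
  rw [← AdjoinRoot.mk_X, ← map_pow, AdjoinRoot.mk_eq_zero] at hm'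
  exact eq_of_monic_of_associated hm monic_X (hp.associated_of_dvd irreducible_X
    (hp.prime.dvd_of_dvd_pow ((dvd_pow_self p hn.ne').trans hm')))

theorem IsSumOfKronReg.one_endoPair {E : Type} [AddCommGroup E] [Module K E]
    [FiniteDimensional K E] {f : Module.End K E} (hf : IsNilpotent f) :
    IsSumOfKronReg (endoPair 1 f) := by
  suffices h : IsSumOfKronReg (endoPair (aeval f (1 : K[X])) (aeval f (X : K[X]))) by
    rwa [aeval_X, map_one] at h
  refine IsSumOfKronReg.endoPair_aeval f 1 X fun p n _ hm hp ⟨π, hπ, hπf⟩ => ?_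
  rcases Nat.eq_zero_or_pos n with rfl | hn
  · have := subsingleton_adjoinRoot_pow_zero p
    exact @IsSumOfKronReg.of_subsingleton _ _ (endoPair _ _) this this
  have hnil : IsNilpotent (AdjoinRoot.root (p ^ n)) := by
    obtain ⟨m, hm'⟩ := hf
    refine ⟨m, ?_⟩
    have hpow (k : ℕ) (x : E) : π ((f ^ k) x) = AdjoinRoot.root (p ^ n) ^ k * π x := by
      induction k with
      | zero => simp
      | succ k ih => rw [pow_succ', Module.End.mul_apply, hπf, ih, pow_succ', mul_assoc]
    obtain ⟨x, hx⟩ := hπ 1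
    simpa [hm', hx] using (hpow m x).symm
  obtain rfl := eq_X_of_isNilpotent_root hn hm hp hnil
  refine IsKronReg.isSumOfKronReg ?_
  rw [AdjoinRoot.mk_X, map_one]
  obtain ⟨β, hβ⟩ := exists_equiv_shift (K := K) n
  exact .inr (.inl ⟨n, hn, β, β, fun x => by simp [endoPair, Tz, ofMats]; rfl, hβ⟩)

/-- Composing both maps of a pair with an automorphism of the target. -/
theorem IsSumOfKronReg.of_unit_mul {E : Type} [AddCommGroup E] [Module K E]
    [FiniteDimensional K E] {f g : Module.End K E} (u : (Module.End K E)ˣ)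
    (h : IsSumOfKronReg (endoPair ((u : Module.End K E) * f) ((u : Module.End K E) * g))) :
    IsSumOfKronReg (endoPair f g) :=
  h.of_iso ⟨.refl K E, LinearMap.GeneralLinearGroup.generalLinearEquiv K E u,
    fun _ => rfl, fun _ => rfl⟩

theorem IsSumOfKronReg.of_isUnit_right {E : Type} [AddCommGroup E] [Module K E]
    [FiniteDimensional K E] {f g : Module.End K E} (hg : IsUnit g) :
    IsSumOfKronReg (endoPair f g) := by
  obtain ⟨u, rfl⟩ := hg
  refine .of_unit_mul u⁻¹ ?_
  rw [Units.inv_mul]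
  exact .endoPair_one _

theorem IsSumOfKronReg.of_isUnit_left {E : Type} [AddCommGroup E] [Module K E]
    [FiniteDimensional K E] {f g : Module.End K E} (hf : IsUnit f) (hg : IsNilpotent g)
    (hc : Commute f g) : IsSumOfKronReg (endoPair f g) := by
  obtain ⟨u, rfl⟩ := hf
  refine .of_unit_mul u⁻¹ ?_
  rw [Units.inv_mul]
  exact .one_endoPair (hc.units_inv_left.isNilpotent_mul_left hg)

theorem IsSumOfKronReg.one_sub_smul {E : Type} [AddCommGroup E] [Module K E]
    [FiniteDimensional K E] (c : K) (f : Module.End K E) :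
    IsSumOfKronReg (endoPair (1 - c • f) f) := by
  suffices h : IsSumOfKronReg (endoPair (aeval f (1 - C c * X)) (aeval f (X : K[X]))) by
    simpa [Algebra.smul_def] using h
  refine IsSumOfKronReg.endoPair_aeval f _ _ fun p n _ hm hp _ => ?_
  by_cases hX : p = X
  · subst hX
    have hnil : IsNilpotent (AdjoinRoot.mk (X ^ n) (X : K[X])) :=
      ⟨n, by rw [← map_pow, AdjoinRoot.mk_self]⟩
    refine .of_isUnit_left ?_ (hnil.map (Algebra.lmul K _)) 
      ((Commute.all _ _).map (Algebra.lmul K (AdjoinRoot ((X : K[X]) ^ n))))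
    refine IsUnit.map (Algebra.lmul K (AdjoinRoot ((X : K[X]) ^ n))) ?_
    rw [map_sub, map_one, map_mul]
    exact ((Commute.all _ _).isNilpotent_mul_left hnil).isUnit_one_sub
  · refine .of_isUnit_right (IsUnit.map (Algebra.lmul K (AdjoinRoot (p ^ n))) ?_)
    have hcop : IsCoprime (p ^ n) X := by
      refine IsCoprime.pow_left (hp.coprime_iff_not_dvd.2 fun hd => hX ?_)
      exact eq_of_monic_of_associated hm monic_X (hp.associated_of_dvd irreducible_X hd)
    obtain ⟨a, b, hab⟩ := hcop
    refine IsUnit.of_mul_eq_one (AdjoinRoot.mk _ b) ?_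
    rw [← map_mul, ← map_one (AdjoinRoot.mk (p ^ n)), ← hab, map_add, map_mul _ a,
      AdjoinRoot.mk_self, mul_zero, zero_add, mul_comm]

end

/-- (Weierstrass) Every regular transformation-pair is isomorphic to a
finite direct sum of pairs of types `^0T_n`, `T^0_n` (`n ≥ 1`) and `S(p^n)`. -/
theorem stmt19 (K : Type) [Field K] (τ : Pair K)
    (hdim : Module.finrank K τ.E = Module.finrank K τ.V)
    (hreg : ∃ c : K, Function.Bijective ⇑(τ.mu + c • τ.nu)) :
    ∃ (k : ℕ) (σ : Fin k → Pair K), (∀ i, IsKronReg K (σ i)) ∧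
      Pair.Iso K τ (dSum K (Fin k) σ) := by
  obtain ⟨c, hc⟩ := hreg
  let γ : τ.E ≃ₗ[K] τ.V := LinearEquiv.ofBijective (τ.mu + c • τ.nu) hc
  have hγ (x) : γ x = τ.mu x + c • τ.nu x := rfl
  let φ : Module.End K τ.E := γ.symm.toLinearMap ∘ₗ τ.nu
  have hφ (x) : φ x = γ.symm (τ.nu x) := rfl
  have hτ : IsSumOfKronReg τ := by
    refine (IsSumOfKronReg.one_sub_smul c φ).of_iso ⟨.refl K _, γ.symm, fun x => ?_, fun x => rfl⟩
    change x - c • φ x = γ.symm (τ.mu x)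
    apply γ.injective
    simp [hφ, hγ x]
  obtain ⟨ι, _, σ, hσ, e⟩ := hτ
  obtain ⟨k, ⟨ε⟩⟩ := Finite.exists_equiv_fin ι
  exact ⟨k, fun i => σ (ε.symm i), fun i => hσ _, e.trans (dSum_reindex ε σ)⟩

end Towber
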